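/- Let a ∈ ℤ^10 with Σᵢ aᵢ = 0, and suppose there is an index t with Q(2E_t − a) ≥ 0. Then at most 5 of the coordinates a₁,…,a₁₀ are nonzero. -/

import Mathlib

/-- The quadratic form `Q(x) = (Σᵢ xᵢ)² − Σᵢ xᵢ²` on `ℤ^10`, the intersection form
of the numerical lattice of an Enriques surface in the basis of half-pencils `Eᵢ`. -/
def Q (x : Fin 10 → ℤ) : ℤ := (∑ i, x i) ^ 2 - ∑ i, (x i) ^ 2

/-- The standard basis vector `Eᵢ` of `ℤ^10` (the half-pencil classes). -/
def E (i : Fin 10) : Fin 10 → ℤ := fun j => if j = i then 1 else 0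

theorem Q_two_smul_E_sub (a : Fin 10 → ℤ) (hsum : ∑ i, a i = 0) (t : Fin 10) :
    Q ((2 : ℤ) • E t - a) = 4 * a t - ∑ i, a i ^ 2 := by
  have hE : ∑ i, E t i = 1 := by simp [E]
  have hsq : ∀ i, (2 * E t i - a i) ^ 2 = 4 * E t i - 4 * (E t i * a i) + a i ^ 2 := by
    intro i
    by_cases h : i = t <;> simp [E, h]
    ring
  have hEa : ∑ i, E t i * a i = a t := by simp [E]
  simp only [Q, Pi.sub_apply, Pi.smul_apply, smul_eq_mul, hsq, Finset.sum_sub_distrib,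
    Finset.sum_add_distrib, ← Finset.mul_sum, hE, hEa, hsum]
  ring

/-- The number of nonzero entries of an integer vector is at most its sum of squares. -/
theorem card_filter_ne_zero_le_sum_sq {ι : Type*} (s : Finset ι) (a : ι → ℤ) :
    ((s.filter fun i => a i ≠ 0).card : ℤ) ≤ ∑ i ∈ s, a i ^ 2 := by
  rw [Finset.card_filter, Nat.cast_sum]
  refine Finset.sum_le_sum fun i _ => ?_
  split_ifs with h
  · exact Int.add_one_le_iff.mpr (sq_pos_of_ne_zero h)
  · exact_mod_cast sq_nonneg (a i)

/-- If `a ∈ ℤ^10` has `Σᵢ aᵢ = 0` and `Q(2Eₜ − a) ≥ 0` for some index `t`, then at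
most `5` of the coordinates of `a` are nonzero. -/
theorem at_most_five_nonzero (a : Fin 10 → ℤ) (hsum : ∑ i, a i = 0)
    (t : Fin 10) (ht : 0 ≤ Q ((2 : ℤ) • E t - a)) :
    (Finset.univ.filter fun i => a i ≠ 0).card ≤ 5 := by
  rw [Q_two_smul_E_sub a hsum t, ← Finset.add_sum_erase _ _ (Finset.mem_univ t)] at ht
  have hle := card_filter_ne_zero_le_sum_sq (Finset.univ.erase t) a
  have hcard : (Finset.univ.filter fun i => a i ≠ 0).card ≤
      ((Finset.univ.erase t).filter fun i => a i ≠ 0).card + 1 := by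
    rw [Finset.filter_erase]
    exact Nat.sub_le_iff_le_add.mp Finset.pred_card_le_card_erase
  have hbound : (((Finset.univ.erase t).filter fun i => a i ≠ 0).card : ℤ) ≤ 4 := by
    nlinarith [sq_nonneg (a t - 2)]
  omega
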